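/- arXiv:1505.02620 — 2 statements merged into one kernel-verified Lean document; each statement's English description precedes it below -/
import Mathlib

section
/- (Proposition 3.1(1).) For all indices i > j, the q-Serre-like element (e^i)²e^j + q·e^j(e^i)² − (1+q)·e^ie^je^i of the free braided vector algebra V(R) lies in the radical of the dual pairing: ⟨f, (e^i)²e^j + q·e^j(e^i)² − (1+q)·e^ie^je^i⟩ = 0 for every f ∈ T(V*). -/
set_option synthInstance.maxHeartbeats 1000000
set_option maxHeartbeats 1000000

noncomputable section

open TensorProduct

/-- The ground field `k = ℚ(q)`. -/
abbrev kk : Type := RatFunc ℚ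

/-- The generic parameter `q`. -/
def qq : kk := RatFunc.X

/-- `T(V) = k⟨e¹, …, eⁿ⟩`, the free (tensor) algebra on `V = k^n`. -/
abbrev TA (n : ℕ) : Type := FreeAlgebra kk (Fin n)

/-- `T(V) ⊗ T(V)`. -/
abbrev T2 (n : ℕ) : Type := TA n ⊗[kk] TA n

/-- The generator `e^i` of the free algebra. -/
def g (n : ℕ) (i : Fin n) : TA n := FreeAlgebra.ι kk i

/-- The multiplication of `T(V)` as a linear map `T(V) ⊗ T(V) → T(V)`. -/
def mulmap (n : ℕ) : T2 n →ₗ[kk] TA n := LinearMap.mul' kk (TA n)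

/-- The associator `(T⊗T)⊗T ≃ T⊗(T⊗T)`. -/
def asso (n : ℕ) : (T2 n ⊗[kk] TA n) ≃ₗ[kk] TA n ⊗[kk] T2 n :=
  TensorProduct.assoc kk (TA n) (TA n) (TA n)

/-- Reassociation `(T⊗T)⊗(T⊗T) ≃ T⊗((T⊗T)⊗T)` isolating the middle two factors. -/
def thetaT (n : ℕ) : (T2 n ⊗[kk] T2 n) ≃ₗ[kk] TA n ⊗[kk] (T2 n ⊗[kk] TA n) :=
  (TensorProduct.assoc kk (TA n) (TA n) (T2 n)).trans
    (LinearEquiv.lTensor (TA n) (TensorProduct.assoc kk (TA n) (TA n) (TA n)).symm)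

/-- The multiplication of the braided tensor product algebra `T(V) ⊗ T(V)`
determined by a braiding `Ψ`:  `(a⊗b)(c⊗d) = a·Ψ(b⊗c)·d`. -/
def BM (n : ℕ) (Ψ : T2 n →ₗ[kk] T2 n) : (T2 n ⊗[kk] T2 n) →ₗ[kk] T2 n :=
  TensorProduct.map (mulmap n) (mulmap n) ∘ₗ (thetaT n).symm.toLinearMap
    ∘ₗ LinearMap.lTensor (TA n) (LinearMap.rTensor (TA n) Ψ) ∘ₗ (thetaT n).toLinearMap

/-- The defining properties of the braiding `Ψ` of `T(V)` with itself: its value on the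
generators (the matrix `ψ = P∘R` for the standard type `A_{n-1}` R-matrix), triviality on
the unit, and the two hexagon identities `Ψ_{A⊗B,C} = (Ψ_{A,C}⊗id)∘(id⊗Ψ_{B,C})` and
`Ψ_{A,B⊗C} = (id⊗Ψ_{A,C})∘(Ψ_{A,B}⊗id)` expressing that `Ψ` is obtained by composing
`ψ` on adjacent tensor factors. -/
structure IsBraiding (n : ℕ) (Ψ : T2 n →ₗ[kk] T2 n) : Prop where
  unit_right : ∀ a : TA n, Ψ (a ⊗ₜ[kk] 1) = 1 ⊗ₜ[kk] a
  unit_left : ∀ a : TA n, Ψ (1 ⊗ₜ[kk] a) = a ⊗ₜ[kk] 1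
  gen : ∀ i j : Fin n, Ψ (g n i ⊗ₜ[kk] g n j) =
    if i = j then qq • (g n j ⊗ₜ[kk] g n i)
    else if i < j then g n j ⊗ₜ[kk] g n i
    else g n j ⊗ₜ[kk] g n i + (qq - qq⁻¹) • (g n i ⊗ₜ[kk] g n j)
  hex_left : Ψ ∘ₗ LinearMap.rTensor (TA n) (mulmap n) ∘ₗ (asso n).symm.toLinearMap
    = LinearMap.lTensor (TA n) (mulmap n) ∘ₗ (asso n).toLinearMap
      ∘ₗ LinearMap.rTensor (TA n) Ψ ∘ₗ (asso n).symm.toLinearMap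
      ∘ₗ LinearMap.lTensor (TA n) Ψ
  hex_right : Ψ ∘ₗ LinearMap.lTensor (TA n) (mulmap n)
    = LinearMap.rTensor (TA n) (mulmap n) ∘ₗ (asso n).symm.toLinearMap
      ∘ₗ LinearMap.lTensor (TA n) Ψ ∘ₗ (asso n).toLinearMap
      ∘ₗ LinearMap.rTensor (TA n) Ψ ∘ₗ (asso n).symm.toLinearMap

/-- The defining properties of the braided coproduct `Δ` of the free braided vector
algebra `V(R)`: it is the unique algebra homomorphism into the braided tensor product
with `Δ(e^i) = e^i⊗1 + 1⊗e^i`. -/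
structure IsCoproduct (n : ℕ) (Ψ : T2 n →ₗ[kk] T2 n) (Δ : TA n →ₗ[kk] T2 n) : Prop where
  one : Δ 1 = 1 ⊗ₜ[kk] 1
  gen : ∀ i : Fin n, Δ (g n i) = g n i ⊗ₜ[kk] 1 + 1 ⊗ₜ[kk] g n i
  mul : ∀ a b : TA n, Δ (a * b) = BM n Ψ (Δ a ⊗ₜ[kk] Δ b)

/-- Given the pairing `B` and `c, d`, the linear map `T⊗T → k`, `b₁⊗b₂ ↦ ⟨c,b₁⟩⟨d,b₂⟩`. -/
def pairR (n : ℕ) (B : TA n →ₗ[kk] TA n →ₗ[kk] kk) (c d : TA n) : T2 n →ₗ[kk] kk :=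
  (TensorProduct.lid kk kk).toLinearMap ∘ₗ TensorProduct.map (B c) (B d)

/-- Given the pairing `B` and `a, b`, the linear map `T⊗T → k`, `c₁⊗c₂ ↦ ⟨c₁,a⟩⟨c₂,b⟩`. -/
def pairL (n : ℕ) (B : TA n →ₗ[kk] TA n →ₗ[kk] kk) (a b : TA n) : T2 n →ₗ[kk] kk :=
  (TensorProduct.lid kk kk).toLinearMap ∘ₗ TensorProduct.map (B.flip a) (B.flip b)

/-- The defining properties of the dual pairing `⟨·,·⟩ : T(V*) × T(V) → k` (both factors
realized as the free algebra on `n` generators, `f_i` resp. `e^i` being the `i`-th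
generator): `⟨1,1⟩ = 1`, `⟨f_i, e^j⟩ = δ_{ij}`, elements of different homogeneous degrees
pair to zero, `⟨cd, b⟩ = ⟨c, b₍₁₎⟩⟨d, b₍₂₎⟩` and `⟨c, ab⟩ = ⟨c₍₁₎, a⟩⟨c₍₂₎, b⟩`, where the
(braided) coproducts of both factors are given by `Δ`. -/
structure IsPairing (n : ℕ) (Δ : TA n →ₗ[kk] T2 n)
    (B : TA n →ₗ[kk] TA n →ₗ[kk] kk) : Prop where
  one : B 1 1 = 1
  gen : ∀ i j : Fin n, B (g n i) (g n j) = if i = j then 1 else 0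
  deg : ∀ w v : List (Fin n), w.length ≠ v.length →
    B ((w.map (g n)).prod) ((v.map (g n)).prod) = 0
  mul_left : ∀ c d b : TA n, B (c * d) b = pairR n B c d (Δ b)
  mul_right : ∀ c a b : TA n, B c (a * b) = pairL n B a b (Δ c)

theorem BM_tmul (n : ℕ) (Ψ : T2 n →ₗ[kk] T2 n) (u v c d : TA n) :
    BM n Ψ ((u ⊗ₜ[kk] v) ⊗ₜ[kk] (c ⊗ₜ[kk] d)) =
      TensorProduct.map (LinearMap.mulLeft kk u) (LinearMap.mulRight kk d)
        (Ψ (v ⊗ₜ[kk] c)) := by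
  simp only [BM, thetaT, mulmap, LinearMap.comp_apply, LinearEquiv.coe_coe,
    LinearEquiv.trans_apply, TensorProduct.assoc_tmul, LinearEquiv.lTensor_tmul,
    TensorProduct.assoc_symm_tmul, LinearMap.lTensor_tmul, LinearMap.rTensor_tmul]
  induction Ψ (v ⊗ₜ[kk] c) using TensorProduct.induction_on with
  | zero => simp
  | tmul x y => simp [LinearEquiv.trans_symm, LinearEquiv.lTensor, LinearEquiv.trans_apply]
  | add x y hx hy => simp only [add_tmul, tmul_add, map_add, hx, hy]

/-- The left hexagon identity, evaluated on pure tensors. -/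
theorem IsBraiding.mul_tmul {n : ℕ} {Ψ : T2 n →ₗ[kk] T2 n} (hΨ : IsBraiding n Ψ)
    (a b c : TA n) :
    Ψ ((a * b) ⊗ₜ[kk] c) = LinearMap.lTensor (TA n) (mulmap n) (asso n
      (LinearMap.rTensor (TA n) Ψ ((asso n).symm (a ⊗ₜ[kk] Ψ (b ⊗ₜ[kk] c))))) := by
  simpa [asso, mulmap] using LinearMap.congr_fun hΨ.hex_left (a ⊗ₜ[kk] (b ⊗ₜ[kk] c))

theorem IsCoproduct.mul_gen {n : ℕ} {Ψ Δ} (hΨ : IsBraiding n Ψ) (hΔ : IsCoproduct n Ψ Δ)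
    (a b : Fin n) :
    Δ (g n a * g n b) = (g n a * g n b) ⊗ₜ[kk] 1 + g n a ⊗ₜ[kk] g n b
      + Ψ (g n a ⊗ₜ[kk] g n b) + 1 ⊗ₜ[kk] (g n a * g n b) := by
  simp only [hΔ.mul, hΔ.gen, add_tmul, tmul_add, map_add, BM_tmul, hΨ.unit_left, hΨ.unit_right,
    TensorProduct.map_tmul, LinearMap.mulLeft_apply, LinearMap.mulRight_apply, one_mul, mul_one,
    LinearMap.mulLeft_one, LinearMap.mulRight_one, TensorProduct.map_id, LinearMap.id_apply]
  abel

/-- The element `(e^i)²e^j + q·e^j(e^i)² − (1+q)·e^ie^je^i` pairs to zero with every left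
multiple of a generator. -/
theorem IsPairing.mul_gen_serre {n : ℕ} {Ψ Δ B} (hΨ : IsBraiding n Ψ) (hΔ : IsCoproduct n Ψ Δ)
    (hB : IsPairing n Δ B) {i j : Fin n} (hij : j < i) (w : TA n) (c : Fin n) :
    B (w * g n c) (g n i * g n i * g n j + qq • (g n j * (g n i * g n i))
      - (1 + qq) • (g n i * g n j * g n i)) = 0 := by
  have h0 : B (g n c) 1 = 0 := by simpa using hB.deg [c] [] (by simp)
  have h2 (a b : Fin n) : B (g n c) (g n a * g n b) = 0 := by
    simpa using hB.deg [c] [a, b] (by simp)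
  have h3 (a b d : Fin n) : B (g n c) (g n a * g n b * g n d) = 0 := by
    simpa [mul_assoc] using hB.deg [c] [a, b, d] (by simp)
  have hii := hΨ.gen i i
  have hij' := hΨ.gen i j
  have hji := hΨ.gen j i
  rw [if_pos rfl] at hii
  rw [if_neg hij.ne', if_neg hij.not_gt] at hij'
  rw [if_neg hij.ne, if_pos hij] at hji
  have hq : qq ≠ 0 := RatFunc.X_ne_zero
  rw [hB.mul_left, ← mul_assoc]
  simp only [map_add, map_sub, map_smul, hΔ.mul (_ * _) (g n _), hΔ.mul_gen hΨ, hΔ.gen,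
    hii, hij', hji, add_tmul, tmul_add, ← smul_tmul', tmul_smul, BM_tmul, hΨ.mul_tmul,
    hΨ.unit_left, hΨ.unit_right, asso, mulmap, TensorProduct.assoc_tmul,
    TensorProduct.assoc_symm_tmul, LinearMap.lTensor_tmul, LinearMap.rTensor_tmul,
    LinearMap.mul'_apply, TensorProduct.map_tmul, LinearMap.mulLeft_apply,
    LinearMap.mulRight_apply, one_mul, mul_one, pairR, LinearMap.comp_apply, LinearEquiv.coe_coe,
    TensorProduct.lid_tmul, smul_eq_mul, h0, h2, h3, mul_zero, add_zero, zero_add]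
  field_simp
  ring

/-- Proposition 3.1(1).  For all indices `i > j`, the q-Serre-like
element `(e^i)²e^j + q·e^j(e^i)² − (1+q)·e^ie^je^i` of the free braided vector algebra
`V(R)` lies in the radical of the dual pairing:
`⟨f, (e^i)²e^j + q·e^j(e^i)² − (1+q)·e^ie^je^i⟩ = 0` for every `f ∈ T(V*)`. -/
theorem statement6 (n : ℕ) (hn : 2 ≤ n)
    (Ψ : T2 n →ₗ[kk] T2 n) (hΨ : IsBraiding n Ψ)
    (Δ : TA n →ₗ[kk] T2 n) (hΔ : IsCoproduct n Ψ Δ)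
    (B : TA n →ₗ[kk] TA n →ₗ[kk] kk) (hB : IsPairing n Δ B)
    (i j : Fin n) (hij : j < i) (f : TA n) :
    B f (g n i * g n i * g n j + qq • (g n j * (g n i * g n i))
      - (1 + qq) • (g n i * g n j * g n i)) = 0 := by
  have hone : B 1 (g n i * g n i * g n j + qq • (g n j * (g n i * g n i))
      - (1 + qq) • (g n i * g n j * g n i)) = 0 := by
    have h3 (a b d : Fin n) : B 1 (g n a * g n b * g n d) = 0 := by
      simpa [mul_assoc] using hB.deg [] [a, b, d] (by simp)
    simp only [← mul_assoc, map_add, map_sub, map_smul, h3, smul_zero, add_zero, sub_zero]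
  generalize hx : (g n i * g n i * g n j + qq • (g n j * (g n i * g n i))
      - (1 + qq) • (g n i * g n j * g n i)) = x at hone ⊢
  have hgen (w : TA n) (c : Fin n) : B (w * g n c) x = 0 :=
    hx ▸ hB.mul_gen_serre hΨ hΔ hij w c
  suffices h : ∀ w : TA n, B w x = 0 → B (w * f) x = 0 by simpa using h 1 hone
  induction f using FreeAlgebra.induction with
  | grade0 r =>
    intro w hw
    rw [← Algebra.commutes, ← Algebra.smul_def, map_smul, LinearMap.smul_apply, hw, smul_zero]
  | grade1 c => exact fun w _ => hgen w c
  | mul a b ha hb => exact fun w hw => by rw [← mul_assoc]; exact hb _ (ha w hw)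
  | add a b ha hb =>
    intro w hw
    rw [mul_add, map_add, LinearMap.add_apply, ha w hw, hb w hw, add_zero]
end
end

section
/- (Majid's normalization recipe, Remark 2.3, used to produce the dually paired braided (co)vector algebras.) Let R : V⊗V → V⊗V be invertible, satisfy the quantum Yang–Baxter equation R₁₂R₁₃R₂₃ = R₂₃R₁₃R₁₂ on V^{⊗3}, and suppose P∘R satisfies a polynomial equation ∏_{j=1}^{m}(PR − x_j·id) = 0 with scalars x_1, …, x_m ∈ k such that x_i = −1 for some fixed i. Set R' = P + P∘∏_{j≠i}(PR − x_j·id). Then: (i) R₁₂R₁₃R'₂₃ = R'₂₃R₁₃R₁₂ and R₂₃R₁₃R'₁₂ = R'₁₂R₁₃R₂₃; (ii) (PR + id)∘(PR' − id) = 0; (iii) R₂₁R'₁₂ = R'₂₁R₁₂, where M₂₁ := P∘M∘P. -/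
set_option synthInstance.maxHeartbeats 1000000
set_option maxHeartbeats 1000000

noncomputable section

open TensorProduct Polynomial

variable (K : Type*) [Field K] (V : Type*) [AddCommGroup V] [Module K V]

/-- The flip `P(u⊗v) = v⊗u` on `V⊗V`. -/
def Pf : V ⊗[K] V →ₗ[K] V ⊗[K] V := (TensorProduct.comm K V V).toLinearMap

/-- The associator `(V⊗V)⊗V ≃ V⊗(V⊗V)`. -/
def as3 : (V ⊗[K] V) ⊗[K] V ≃ₗ[K] V ⊗[K] (V ⊗[K] V) := TensorProduct.assoc K V V V

/-- `M₁₂`: a map of `V⊗V` applied to the tensor factors `(1,2)` of `V^{⊗3}`,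
the identity on the remaining factor. -/
def o12 (M : V ⊗[K] V →ₗ[K] V ⊗[K] V) : V ⊗[K] (V ⊗[K] V) →ₗ[K] V ⊗[K] (V ⊗[K] V) :=
  (as3 K V).toLinearMap ∘ₗ LinearMap.rTensor V M ∘ₗ (as3 K V).symm.toLinearMap

/-- `M₂₃`: a map of `V⊗V` applied to the tensor factors `(2,3)` of `V^{⊗3}`. -/
def o23 (M : V ⊗[K] V →ₗ[K] V ⊗[K] V) : V ⊗[K] (V ⊗[K] V) →ₗ[K] V ⊗[K] (V ⊗[K] V) :=
  LinearMap.lTensor V M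

/-- `M₁₃`: a map of `V⊗V` applied to the tensor factors `(1,3)` of `V^{⊗3}`. -/
def o13 (M : V ⊗[K] V →ₗ[K] V ⊗[K] V) : V ⊗[K] (V ⊗[K] V) →ₗ[K] V ⊗[K] (V ⊗[K] V) :=
  o23 K V (Pf K V) ∘ₗ o12 K V M ∘ₗ o23 K V (Pf K V)

/-- `M₂₁ := P∘M∘P`. -/
def tw (M : V ⊗[K] V →ₗ[K] V ⊗[K] V) : V ⊗[K] V →ₗ[K] V ⊗[K] V :=
  Pf K V ∘ₗ M ∘ₗ Pf K V

/-- `M ↦ M₁₂` as a homomorphism of algebras. -/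
def legOneTwoHom : Module.End K (V ⊗[K] V) →ₐ[K] Module.End K (V ⊗[K] (V ⊗[K] V)) :=
  ((as3 K V).conjAlgEquiv K).toAlgHom.comp (Module.End.rTensorAlgHom K (V ⊗[K] V) V)

/-- `M ↦ M₂₃` as a homomorphism of algebras. -/
def legTwoThreeHom : Module.End K (V ⊗[K] V) →ₐ[K] Module.End K (V ⊗[K] (V ⊗[K] V)) :=
  Module.End.lTensorAlgHom K (V ⊗[K] V) V

lemma Pf_mul_self : (Pf K V * Pf K V : Module.End K (V ⊗[K] V)) = 1 := by
  ext u v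
  simp [Pf]

lemma o12_mul (M N : Module.End K (V ⊗[K] V)) :
    (o12 K V (M * N) : Module.End K (V ⊗[K] (V ⊗[K] V))) = o12 K V M * o12 K V N :=
  map_mul (legOneTwoHom K V) M N

lemma o23_mul (M N : Module.End K (V ⊗[K] V)) :
    (o23 K V (M * N) : Module.End K (V ⊗[K] (V ⊗[K] V))) = o23 K V M * o23 K V N :=
  map_mul (legTwoThreeHom K V) M N

lemma o12_Pf_mul_self :
    (o12 K V (Pf K V) * o12 K V (Pf K V) : Module.End K (V ⊗[K] (V ⊗[K] V))) = 1 := by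
  rw [← o12_mul, Pf_mul_self]
  exact map_one (legOneTwoHom K V)

lemma o23_Pf_mul_self :
    (o23 K V (Pf K V) * o23 K V (Pf K V) : Module.End K (V ⊗[K] (V ⊗[K] V))) = 1 := by
  rw [← o23_mul, Pf_mul_self]
  exact map_one (legTwoThreeHom K V)

lemma o12_Pf_o23_Pf_as3 (t : V ⊗[K] V) (u : V) :
    o12 K V (Pf K V) (o23 K V (Pf K V) (as3 K V (t ⊗ₜ u))) = u ⊗ₜ t := by
  induction t with
  | zero => simp
  | tmul a b => simp [o12, o23, as3, Pf]
  | add a b ha hb => simp only [TensorProduct.add_tmul, TensorProduct.tmul_add, map_add, ha, hb]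

lemma o12_Pf_mul_o13 (M : Module.End K (V ⊗[K] V)) :
    (o12 K V (Pf K V) * o13 K V M : Module.End K (V ⊗[K] (V ⊗[K] V))) =
      o23 K V M * o12 K V (Pf K V) := by
  have h : (o12 K V (Pf K V) * o13 K V M * o12 K V (Pf K V) :
      Module.End K (V ⊗[K] (V ⊗[K] V))) = o23 K V M := by
    ext u v w
    have h₀ : o23 K V (Pf K V) (o12 K V (Pf K V) (u ⊗ₜ (v ⊗ₜ w))) =
        as3 K V ((v ⊗ₜ w) ⊗ₜ u) := by
      simp [o12, o23, as3, Pf]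
    have h₁ : o12 K V M (as3 K V ((v ⊗ₜ w) ⊗ₜ u)) = as3 K V (M (v ⊗ₜ w) ⊗ₜ u) := by
      simp [o12]
    simp only [TensorProduct.AlgebraTensorModule.curry_apply, TensorProduct.curry_apply,
      LinearMap.restrictScalars_self, Module.End.mul_apply, o13, LinearMap.comp_apply, h₀, h₁, o12_Pf_o23_Pf_as3]
    rfl
  rw [← h, mul_assoc _ (o12 K V (Pf K V)), o12_Pf_mul_self, mul_one]

lemma o13_mul_o12_Pf (M : Module.End K (V ⊗[K] V)) :
    (o13 K V M * o12 K V (Pf K V) : Module.End K (V ⊗[K] (V ⊗[K] V))) =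
      o12 K V (Pf K V) * o23 K V M := by
  calc _ = o12 K V (Pf K V) * (o12 K V (Pf K V) * o13 K V M) * o12 K V (Pf K V) := by
        rw [← mul_assoc, o12_Pf_mul_self, one_mul]
    _ = _ := by
        rw [o12_Pf_mul_o13, mul_assoc, mul_assoc, o12_Pf_mul_self, mul_one]

lemma o13_mul_o23_Pf (M : Module.End K (V ⊗[K] V)) :
    (o13 K V M * o23 K V (Pf K V) : Module.End K (V ⊗[K] (V ⊗[K] V))) =
      o23 K V (Pf K V) * o12 K V M := by
  change o23 K V (Pf K V) * (o12 K V M * o23 K V (Pf K V)) * o23 K V (Pf K V) = _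
  rw [mul_assoc, mul_assoc, o23_Pf_mul_self, mul_one]

lemma o12_mul_o23_Pf (M : Module.End K (V ⊗[K] V)) :
    (o12 K V M * o23 K V (Pf K V) : Module.End K (V ⊗[K] (V ⊗[K] V))) =
      o23 K V (Pf K V) * o13 K V M := by
  change _ = o23 K V (Pf K V) * (o23 K V (Pf K V) * (o12 K V M * o23 K V (Pf K V)))
  rw [← mul_assoc, o23_Pf_mul_self, one_mul]

lemma mul_o23_Pf_mul_eq_iff (R N : Module.End K (V ⊗[K] V)) :
    (o12 K V R * (o13 K V R * o23 K V (Pf K V * N)) : Module.End K (V ⊗[K] (V ⊗[K] V))) =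
        o23 K V (Pf K V * N) * (o13 K V R * o12 K V R) ↔
      Commute (o13 K V R * o12 K V R : Module.End K (V ⊗[K] (V ⊗[K] V))) (o23 K V N) := by
  rw [o23_mul, ← mul_assoc (o13 K V R), o13_mul_o23_Pf, mul_assoc, ← mul_assoc (o12 K V R),
    o12_mul_o23_Pf, mul_assoc, mul_assoc, ← mul_assoc (o13 K V R)]
  exact (isLeftRegular_of_mul_eq_one (o23_Pf_mul_self K V) : Function.Injective _).eq_iff

lemma mul_o12_Pf_mul_eq_iff (R N : Module.End K (V ⊗[K] V)) :
    (o23 K V R * (o13 K V R * o12 K V (Pf K V * N)) : Module.End K (V ⊗[K] (V ⊗[K] V))) =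
        o12 K V (Pf K V * N) * (o13 K V R * o23 K V R) ↔
      Commute (o13 K V R * o23 K V R : Module.End K (V ⊗[K] (V ⊗[K] V))) (o12 K V N) := by
  rw [o12_mul, ← mul_assoc (o13 K V R), o13_mul_o12_Pf, mul_assoc, ← mul_assoc (o23 K V R),
    ← o12_Pf_mul_o13, mul_assoc, mul_assoc, ← mul_assoc (o13 K V R)]
  exact (isLeftRegular_of_mul_eq_one (o12_Pf_mul_self K V) : Function.Injective _).eq_iff

lemma commute_map_aeval {A B : Type*} [Ring A] [Algebra K A] [Ring B] [Algebra K B]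
    (φ : A →ₐ[K] B) {a : A} {b : B} (h : Commute b (φ a)) (p : K[X]) :
    Commute b (φ (aeval a p)) := by
  induction p using Polynomial.induction_on' with
  | add p q hp hq => simpa only [map_add] using hp.add_right hq
  | monomial n c =>
    simpa only [aeval_monomial, map_mul, map_pow, AlgHom.commutes] using
      (Algebra.commute_algebraMap_right c b).mul_right (h.pow_right n)

/-- Majid's normalization recipe, Remark 2.3.  Let `R : V⊗V → V⊗V` be
invertible, satisfy the quantum Yang–Baxter equation, and suppose `P∘R` satisfies a
polynomial equation `∏_{j=1}^{m}(PR − x_j·id) = 0` with `x_i = −1` for some fixed `i`.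
Set `R' = P + P∘∏_{j≠i}(PR − x_j·id)`.  Then
(i) `R₁₂R₁₃R'₂₃ = R'₂₃R₁₃R₁₂` and `R₂₃R₁₃R'₁₂ = R'₁₂R₁₃R₂₃`;
(ii) `(PR + id)∘(PR' − id) = 0`;
(iii) `R₂₁R'₁₂ = R'₂₁R₁₂`. -/
theorem statement12 [FiniteDimensional K V]
    (m : ℕ) (x : Fin m → K) (i : Fin m) (hx : x i = -1)
    (R : V ⊗[K] V →ₗ[K] V ⊗[K] V) (hR : Function.Bijective R)
    (hYB : o12 K V R ∘ₗ o13 K V R ∘ₗ o23 K V R = o23 K V R ∘ₗ o13 K V R ∘ₗ o12 K V R)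
    (hpoly : Polynomial.aeval ((Pf K V ∘ₗ R : V ⊗[K] V →ₗ[K] V ⊗[K] V) :
        Module.End K (V ⊗[K] V)) (∏ j : Fin m, (Polynomial.X - Polynomial.C (x j))) = 0)
    (R' : V ⊗[K] V →ₗ[K] V ⊗[K] V)
    (hR' : R' = Pf K V + Pf K V ∘ₗ
      (Polynomial.aeval ((Pf K V ∘ₗ R : V ⊗[K] V →ₗ[K] V ⊗[K] V) : Module.End K (V ⊗[K] V))
        (∏ j ∈ Finset.univ.erase i, (Polynomial.X - Polynomial.C (x j))) :
          V ⊗[K] V →ₗ[K] V ⊗[K] V)) :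
    (o12 K V R ∘ₗ o13 K V R ∘ₗ o23 K V R' = o23 K V R' ∘ₗ o13 K V R ∘ₗ o12 K V R) ∧
    (o23 K V R ∘ₗ o13 K V R ∘ₗ o12 K V R' = o12 K V R' ∘ₗ o13 K V R ∘ₗ o23 K V R) ∧
    ((Pf K V ∘ₗ R + LinearMap.id) ∘ₗ (Pf K V ∘ₗ R' - LinearMap.id) = 0) ∧
    (tw K V R ∘ₗ R' = tw K V R' ∘ₗ R) := by
  set S : Module.End K (V ⊗[K] V) := Pf K V * R with hS
  set p : K[X] := ∏ j ∈ Finset.univ.erase i, (X - C (x j)) with hp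
  have hPS : Pf K V * S = R := by rw [hS, ← mul_assoc, Pf_mul_self, one_mul]
  have hPR' : R' = Pf K V * aeval S (1 + p) := by
    rw [hR', map_add, map_one, mul_add, mul_one]
    rfl
  have hPPR' : Pf K V * R' = aeval S (1 + p) := by
    rw [hPR', ← mul_assoc, Pf_mul_self, one_mul]
  refine ⟨?_, ?_, ?_, ?_⟩
  · rw [hPR']
    refine (mul_o23_Pf_mul_eq_iff K V R _).2 (commute_map_aeval K (legTwoThreeHom K V) ?_ _)
    refine (mul_o23_Pf_mul_eq_iff K V R S).1 ?_
    rw [hPS]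
    exact hYB
  · rw [hPR']
    refine (mul_o12_Pf_mul_eq_iff K V R _).2 (commute_map_aeval K (legOneTwoHom K V) ?_ _)
    refine (mul_o12_Pf_mul_eq_iff K V R S).1 ?_
    rw [hPS]
    exact hYB.symm
  · change (S + 1) * (Pf K V * R' - 1) = 0
    have hfactor : (X + 1) * p = ∏ j, (X - C (x j)) := by
      rw [← Finset.mul_prod_erase Finset.univ _ (Finset.mem_univ i), hx]
      simp [hp]
    have hzero : aeval S ((X + 1) * p) = 0 := hfactor ▸ hpoly
    rw [hPPR', map_add, map_one, add_sub_cancel_left]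
    simpa using hzero
  · change Pf K V * (R * Pf K V) * R' = Pf K V * (R' * Pf K V) * R
    have hcomm : S * aeval S (1 + p) = aeval S (1 + p) * S :=
      commute_map_aeval K (AlgHom.id K _) (Commute.refl S) _
    calc Pf K V * (R * Pf K V) * R' = S * (Pf K V * R') := by simp only [hS, mul_assoc]
      _ = (Pf K V * R') * S := by rw [hPPR', hcomm]
      _ = Pf K V * (R' * Pf K V) * R := by simp only [hS, mul_assoc]
end
end
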